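/- arXiv:1904.02725 — 15 statements merged into one kernel-verified Lean document; each statement's English description precedes it below -/
import Mathlib

section
/- Let U ⊆ ℝⁿ be an open set and let g : ℝⁿ → ℝ be smooth on U. Then there exist smooth functions h, k : ℝⁿ → ℝ such that {x ∈ ℝⁿ : k(x) ≠ 0} = U and g(x)·k(x) = h(x) for every x ∈ U. -/
open Set Function Filter Topology in
open scoped NNReal ContDiff in
theorem aux_frac {E : Type*} [NormedAddCommGroup E] [NormedSpace ℝ E] [FiniteDimensional ℝ E]
    {s : Set E} (hs : IsOpen s) (h's : s.Nonempty) (φ : E → ℝ) (hφ : ContDiffOn ℝ ∞ φ s) :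
    ∃ K : E → ℝ × ℝ, ContDiff ℝ ∞ K ∧ (∀ x, (K x).1 ≠ 0 ↔ x ∈ s) ∧
      ∀ x, (K x).2 = (K x).1 * φ x := by
  let ι := { f : E → ℝ // tsupport f ⊆ s ∧ HasCompactSupport f ∧ ContDiff ℝ ∞ f ∧
    range f ⊆ Icc 0 1 }
  obtain ⟨T, T_count, hT⟩ : ∃ T : Set ι, T.Countable ∧ ⋃ f ∈ T, support (f : E → ℝ) = s := by
    have : ⋃ f : ι, (f : E → ℝ).support = s := by
      refine Subset.antisymm (iUnion_subset fun f => (subset_tsupport _).trans f.2.1) ?_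
      intro x hx
      rcases exists_contDiff_tsupport_subset (n := ⊤) (hs.mem_nhds hx) with ⟨f, hf⟩
      let g : ι := ⟨f, hf.1, hf.2.1, hf.2.2.1, hf.2.2.2.1⟩
      have : x ∈ support (g : E → ℝ) := by
        simp only [g, hf.2.2.2.2, mem_support, Ne, one_ne_zero, not_false_iff]
      exact mem_iUnion_of_mem _ this
    simp_rw [← this]
    apply TopologicalSpace.isOpen_iUnion_countable
    rintro ⟨f, hf⟩
    exact hf.2.2.1.continuous.isOpen_support
  obtain ⟨g0, hg⟩ : ∃ g0 : ℕ → ι, T = range g0 := by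
    apply Countable.exists_eq_range T_count
    rcases eq_empty_or_nonempty T with (rfl | hT)
    · simp only [← hT, mem_empty_iff_false, iUnion_of_empty, iUnion_empty, Set.not_nonempty_empty]
        at h's
    · exact hT
  let b : ℕ → E → ℝ := fun n => (g0 n).1
  have b_ts : ∀ n, tsupport (b n) ⊆ s := fun n => (g0 n).2.1
  have s_b : ∀ x ∈ s, ∃ n, b n x ≠ 0 := fun x hx ↦ by
    rw [← hT] at hx
    obtain ⟨i, iT, hi⟩ : ∃ i ∈ T, x ∈ support (i : E → ℝ) := by
      simpa only [mem_iUnion, exists_prop] using! hx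
    rw [hg] at iT
    obtain ⟨n, rfl⟩ := iT
    exact ⟨n, hi⟩
  have b_smooth : ∀ n, ContDiff ℝ ∞ (b n) := fun n => (g0 n).2.2.2.1
  have b_comp_supp : ∀ n, HasCompactSupport (b n) := fun n => (g0 n).2.2.1
  have b_nonneg : ∀ n x, 0 ≤ b n x := fun n x => ((g0 n).2.2.2.2 (mem_range_self x)).1
  let g : ℕ → E → ℝ × ℝ := fun n x => b n x • ((1 : ℝ), φ x)
  have g_ts : ∀ n, tsupport (g n) ⊆ tsupport (b n) := fun n =>
    closure_mono (support_smul_subset_left (b n) (fun x => ((1 : ℝ), φ x)))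
  have g_smooth : ∀ n, ContDiff ℝ ∞ (g n) := by
    intro n
    rw [contDiff_iff_contDiffAt]
    intro x
    by_cases hx : x ∈ tsupport (g n)
    swap
    · exact contDiffAt_const.congr_of_eventuallyEq (notMem_tsupport_iff_eventuallyEq.1 hx)
    have hx' := b_ts n (g_ts n hx)
    exact (b_smooth n).contDiffAt.smul
      (contDiffAt_const.prodMk (hφ.contDiffAt (hs.mem_nhds hx')))
  have g_comp_supp : ∀ n, HasCompactSupport (g n) := fun n =>
    (b_comp_supp n).of_isClosed_subset (isClosed_tsupport _) (g_ts n)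
  obtain ⟨δ, δpos, c, δc, c_lt⟩ :
      ∃ δ : ℕ → ℝ≥0, (∀ i : ℕ, 0 < δ i) ∧ ∃ c : NNReal, HasSum δ c ∧ c < 1 :=
    NNReal.exists_pos_sum_of_countable one_ne_zero ℕ
  have : ∀ n : ℕ, ∃ r : ℝ, 0 < r ∧ ∀ i ≤ n, ∀ x, ‖iteratedFDeriv ℝ i (r • g n) x‖ ≤ δ n := by
    intro n
    have : ∀ i, ∃ R, ∀ x, ‖iteratedFDeriv ℝ i (fun x => g n x) x‖ ≤ R := by
      intro i
      have : BddAbove (range fun x => ‖iteratedFDeriv ℝ i (fun x : E => g n x) x‖) := by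
        apply ((g_smooth n).continuous_iteratedFDeriv
          (mod_cast le_top)).norm.bddAbove_range_of_hasCompactSupport
        apply HasCompactSupport.comp_left _ norm_zero
        apply (g_comp_supp n).iteratedFDeriv
      rcases this with ⟨R, hR⟩
      exact ⟨R, fun x => hR (mem_range_self _)⟩
    choose R hR using this
    let M := max (((Finset.range (n + 1)).image R).max' (by simp)) 1
    have δnpos : 0 < δ n := δpos n
    have IR : ∀ i ≤ n, R i ≤ M := by
      intro i hi
      refine le_trans ?_ (le_max_left _ _)
      apply Finset.le_max'
      apply Finset.mem_image_of_mem
      simp only [Finset.mem_range]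
      lia
    refine ⟨M⁻¹ * δ n, by positivity, fun i hi x => ?_⟩
    calc
      ‖iteratedFDeriv ℝ i ((M⁻¹ * δ n) • g n) x‖ = ‖(M⁻¹ * δ n) • iteratedFDeriv ℝ i (g n) x‖ := by
        rw [iteratedFDeriv_const_smul_apply]
        exact (g_smooth n).contDiffAt.of_le (mod_cast le_top)
      _ = M⁻¹ * δ n * ‖iteratedFDeriv ℝ i (g n) x‖ := by
        rw [norm_smul _ (iteratedFDeriv ℝ i (g n) x), Real.norm_of_nonneg]; positivity
      _ ≤ M⁻¹ * δ n * M := by gcongr; exact (hR i x).trans (IR i hi)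
      _ = δ n := by simp [field]
  choose r rpos hr using this
  have S : ∀ x, Summable fun n => (r n • g n) x := fun x ↦ by
    refine .of_nnnorm_bounded δc.summable fun n => ?_
    rw [← NNReal.coe_le_coe, coe_nnnorm]
    simpa only [norm_iteratedFDeriv_zero] using! hr n 0 zero_le x
  have S1 : ∀ x, Summable fun n => r n * b n x := fun x ↦ by
    simpa [g] using! (S x).map (ContinuousLinearMap.fst ℝ ℝ ℝ)
      (ContinuousLinearMap.fst ℝ ℝ ℝ).continuous
  have hK : ∀ x, ∑' n, (r n • g n) x = (∑' n, r n * b n x) • ((1 : ℝ), φ x) := fun x ↦ by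
    rw [← (S1 x).tsum_smul_const]
    simp only [g, Pi.smul_apply, smul_smul]
  refine ⟨fun x => ∑' n, (r n • g n) x, ?_, ?_, ?_⟩
  · refine
      contDiff_tsum_of_eventually (fun k => (g_smooth k).const_smul (r k))
        (fun k _ => (NNReal.hasSum_coe.2 δc).summable) ?_
    intro i _
    simp only [Nat.cofinite_eq_atTop, Filter.eventually_atTop]
    exact ⟨i, fun n hn x => hr _ _ hn _⟩
  · intro x
    simp only [hK, Prod.smul_fst, smul_eq_mul, mul_one]
    constructor
    · intro hx
      contrapose! hx
      have : ∀ n, b n x = 0 := by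
        intro n
        by_contra h
        exact hx (b_ts n (subset_tsupport _ h))
      simp only [this, mul_zero, tsum_zero]
    · intro hx
      obtain ⟨n, hn⟩ := s_b x hx
      have I : 0 < r n * b n x := mul_pos (rpos n) (lt_of_le_of_ne (b_nonneg n x) (Ne.symm hn))
      exact ne_of_gt ((S1 x).tsum_pos (fun i => mul_nonneg (rpos i).le (b_nonneg i x)) n I)
  · intro x
    simp only [hK, Prod.smul_fst, Prod.smul_snd, smul_eq_mul, mul_one]

/-- (Ortega–Muñoz) For every open `U ⊆ ℝⁿ` and every `g` smooth on `U`, there are smooth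
`h, k : ℝⁿ → ℝ` with cozero set of `k` equal to `U` and `g · k = h` on `U`. -/
theorem exists_smooth_extension_fraction (n : ℕ) (U : Set (Fin n → ℝ)) (hU : IsOpen U)
    (g : (Fin n → ℝ) → ℝ) (hg : ContDiffOn ℝ (⊤ : ℕ∞) g U) :
    ∃ h k : (Fin n → ℝ) → ℝ, ContDiff ℝ (⊤ : ℕ∞) h ∧ ContDiff ℝ (⊤ : ℕ∞) k ∧
      {x : Fin n → ℝ | k x ≠ 0} = U ∧ ∀ x ∈ U, g x * k x = h x := by
  rcases Set.eq_empty_or_nonempty U with rfl | hne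
  · exact ⟨fun _ => 0, fun _ => 0, contDiff_const, contDiff_const, by simp, by simp⟩
  obtain ⟨K, hK, h1, h2⟩ := aux_frac hU hne g hg
  refine ⟨fun x => (K x).2, fun x => (K x).1, hK.snd, hK.fst, Set.ext h1, fun x _ => ?_⟩
  simp only [h2, mul_comm]
end

section
/- Let φ : ℝⁿ → ℝ be smooth and U_φ := {x ∈ ℝⁿ : φ(x) ≠ 0}. For every function h : ℝⁿ → ℝ that is smooth on U_φ there exists a smooth function f : ℝⁿ × ℝ → ℝ such that h(x) = f(x, φ(x)⁻¹) for every x ∈ U_φ. -/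
/-- Every function `h` smooth on the cozero set `U_φ = {x | φ x ≠ 0}` of a smooth `φ : ℝⁿ → ℝ`
lifts to a smooth `f : ℝⁿ × ℝ → ℝ` with `h x = f (x, (φ x)⁻¹)` for `x ∈ U_φ`. -/
theorem exists_smooth_lift_on_cozero (n : ℕ) (φ : (Fin n → ℝ) → ℝ)
    (hφ : ContDiff ℝ (⊤ : ℕ∞) φ)
    (h : (Fin n → ℝ) → ℝ) (hh : ContDiffOn ℝ (⊤ : ℕ∞) h {x : Fin n → ℝ | φ x ≠ 0}) :
    ∃ f : (Fin n → ℝ) × ℝ → ℝ, ContDiff ℝ (⊤ : ℕ∞) f ∧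
      ∀ x ∈ {x : Fin n → ℝ | φ x ≠ 0}, h x = f (x, (φ x)⁻¹) := by
  refine ⟨fun p => Real.smoothTransition (2 * (p.2 * φ p.1) - 1) * h p.1, ?_, ?_⟩
  · have hφ1 : ContDiff ℝ (⊤ : ℕ∞) (fun p : (Fin n → ℝ) × ℝ => 2 * (p.2 * φ p.1) - 1) :=
      (contDiff_const.mul (contDiff_snd.mul (hφ.comp contDiff_fst))).sub contDiff_const
    rw [contDiff_iff_contDiffAt]
    intro p
    by_cases hp : φ p.1 = 0
    · have hev : ∀ᶠ q in nhds p, 2 * (q.2 * φ q.1) - 1 < 0 :=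
        hφ1.continuous.continuousAt.eventually_lt continuousAt_const (by simp [hp])
      refine (contDiffAt_const (c := (0 : ℝ))).congr_of_eventuallyEq ?_
      filter_upwards [hev] with q hq
      simp [Real.smoothTransition.zero_of_nonpos hq.le]
    · have hopen : IsOpen {x : Fin n → ℝ | φ x ≠ 0} :=
        isOpen_ne_fun hφ.continuous continuous_const
      have hhat : ContDiffAt ℝ (⊤ : ℕ∞) h p.1 := hh.contDiffAt (hopen.mem_nhds hp)
      exact (Real.smoothTransition.contDiff.comp hφ1).contDiffAt.mul
        (hhat.comp p contDiffAt_fst)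
  · intro x hx
    have hx' : φ x ≠ 0 := hx
    have : (2 : ℝ) * ((φ x)⁻¹ * φ x) - 1 = 1 := by
      rw [inv_mul_cancel₀ hx']; norm_num
    simp only [this, Real.smoothTransition.one, one_mul]
end

section
/- Let φ : ℝⁿ → ℝ be smooth and U_φ := {x ∈ ℝⁿ : φ(x) ≠ 0}. If f : ℝⁿ × ℝ → ℝ is smooth and f(x, φ(x)⁻¹) = 0 for every x ∈ U_φ, then there exists a smooth function ν : ℝⁿ × ℝ → ℝ such that f(x,y) = ν(x,y)·(y·φ(x) − 1) for all (x,y) ∈ ℝⁿ × ℝ. -/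
theorem smooth_aux_integral (n : ℕ) {H : Type} [NormedAddCommGroup H] [NormedSpace ℝ H]
    [FiniteDimensional ℝ H] : ∀ {E : Type} [NormedAddCommGroup E] [NormedSpace ℝ E]
    [CompleteSpace E] (F : H × ℝ → E), ContDiff ℝ (⊤ : ℕ∞) F →
    ContDiff ℝ n (fun x => ∫ t in (0:ℝ)..1, F (x, t)) := by
  induction n with
  | zero =>
    intro E _ _ _ F hF
    have hc := hF.continuous
    simp only [Nat.cast_zero]
    rw [contDiff_zero]
    exact intervalIntegral.continuous_parametric_intervalIntegral_of_continuous'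
      (f := fun x t => F (x, t)) (by simpa [Function.uncurry_def] using hc) 0 1
  | succ n ih =>
    intro E _ _ _ F hF
    have hd : Differentiable ℝ F := hF.differentiable (by simp)
    have hfd : ContDiff ℝ (⊤ : ℕ∞) (fderiv ℝ F) := (contDiff_infty_iff_fderiv.1 hF).2
    let F' : H × ℝ → H →L[ℝ] E := fun p => (fderiv ℝ F p).comp (ContinuousLinearMap.inl ℝ H ℝ)
    have hF' : ContDiff ℝ (⊤ : ℕ∞) F' := hfd.clm_comp contDiff_const
    have hc := hF.continuous
    have hc' := hF'.continuous
    push_cast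
    rw [contDiff_succ_iff_hasFDerivAt]
    refine ⟨fun x => ∫ t in (0:ℝ)..1, F' (x, t), ih F' hF', fun x₀ => ?_⟩
    have : ProperSpace H := FiniteDimensional.proper ℝ H
    obtain ⟨C, hC⟩ := ((isCompact_closedBall x₀ 1).prod (isCompact_Icc (a := (0:ℝ)) (b := 1))
      ).exists_bound_of_continuousOn hc'.continuousOn
    refine intervalIntegral.hasFDerivAt_integral_of_dominated_of_fderiv_le
      (F := fun x t => F (x, t)) (F' := fun x t => F' (x, t)) (bound := fun _ => C)
      (Metric.closedBall_mem_nhds x₀ one_pos) ?_ ?_ ?_ ?_ ?_ ?_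
    · exact Filter.Eventually.of_forall fun x =>
        (hc.comp (Continuous.prodMk_right x)).aestronglyMeasurable
    · exact (hc.comp (Continuous.prodMk_right x₀)).intervalIntegrable _ _
    · exact (hc'.comp (Continuous.prodMk_right x₀)).aestronglyMeasurable
    · refine Filter.Eventually.of_forall fun t ht x hx => hC _ ⟨hx, ?_⟩
      rw [Set.uIoc_of_le zero_le_one] at ht
      exact Set.Ioc_subset_Icc_self ht
    · exact intervalIntegrable_const
    · refine Filter.Eventually.of_forall fun t ht x hx => ?_
      exact (hd (x, t)).hasFDerivAt.comp x (hasFDerivAt_prodMk_left x t)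

/-- Kernel description: if `f : ℝⁿ × ℝ → ℝ` is smooth and vanishes at `(x, (φ x)⁻¹)` for every
`x` in the cozero set of the smooth function `φ`, then `f` is a smooth multiple of
`(x, y) ↦ y * φ x - 1`. -/
theorem smooth_mem_principal_ideal_of_vanishing (n : ℕ) (φ : (Fin n → ℝ) → ℝ)
    (hφ : ContDiff ℝ (⊤ : ℕ∞) φ)
    (f : (Fin n → ℝ) × ℝ → ℝ) (hf : ContDiff ℝ (⊤ : ℕ∞) f)
    (hker : ∀ x : Fin n → ℝ, φ x ≠ 0 → f (x, (φ x)⁻¹) = 0) :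
    ∃ ν : (Fin n → ℝ) × ℝ → ℝ, ContDiff ℝ (⊤ : ℕ∞) ν ∧
      ∀ (x : Fin n → ℝ) (y : ℝ), f (x, y) = ν (x, y) * (y * φ x - 1) := by
  let D : (Fin n → ℝ) × ℝ → ℝ := fun p => fderiv ℝ f p (0, 1)
  have hD : ContDiff ℝ (⊤ : ℕ∞) D := (contDiff_infty_iff_fderiv.1 hf).2.clm_apply contDiff_const
  have hd : Differentiable ℝ f := hf.differentiable (by simp)
  let G : (Fin n → ℝ) × ℝ × ℝ → ℝ := fun q =>
    ∫ t in (0:ℝ)..1, D (q.1, q.2.1 + t * (q.2.2 - q.2.1))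
  have hG : ContDiff ℝ (⊤ : ℕ∞) G := by
    rw [contDiff_infty]
    intro k
    exact smooth_aux_integral k
      (fun r : ((Fin n → ℝ) × ℝ × ℝ) × ℝ => D (r.1.1, r.1.2.1 + r.2 * (r.1.2.2 - r.1.2.1)))
      (hD.comp (by fun_prop))
  have key : ∀ x a b, f (x, b) - f (x, a) = (b - a) * G (x, a, b) := by
    intro x a b
    have h1 : ∀ t : ℝ, HasDerivAt (fun t : ℝ => f (x, a + t * (b - a)))
        ((b - a) * D (x, a + t * (b - a))) t := by
      intro t
      have h2 : HasDerivAt (fun t : ℝ => (x, a + t * (b - a))) ((0 : Fin n → ℝ), b - a) t := by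
        refine (hasDerivAt_const t x).prodMk ?_
        simpa using ((hasDerivAt_id t).mul_const (b - a)).const_add a
      have h3 := (hd (x, a + t * (b - a))).hasFDerivAt.comp_hasDerivAt t h2
      have : ((0 : Fin n → ℝ), b - a) = (b - a) • ((0 : Fin n → ℝ), (1 : ℝ)) := by simp
      rw [this, map_smul, smul_eq_mul] at h3
      exact h3
    have hcD : Continuous fun t : ℝ => (b - a) * D (x, a + t * (b - a)) :=
      continuous_const.mul (hD.continuous.comp (by fun_prop))
    have h4 := intervalIntegral.integral_eq_sub_of_hasDerivAt (a := 0) (b := 1)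
      (fun t _ => h1 t) (hcD.intervalIntegrable _ _)
    rw [intervalIntegral.integral_const_mul] at h4
    simp only [one_mul, zero_mul, add_zero, add_sub_cancel] at h4
    exact h4.symm
  classical
  let ν : (Fin n → ℝ) × ℝ → ℝ := fun p =>
    if φ p.1 = 0 then - f p else (φ p.1)⁻¹ * G (p.1, (φ p.1)⁻¹, p.2)
  have hν : ∀ (x : Fin n → ℝ) (y : ℝ), f (x, y) = ν (x, y) * (y * φ x - 1) := by
    intro x y
    by_cases h : φ x = 0
    · simp [ν, h]
    · have h5 := key x (φ x)⁻¹ y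
      rw [hker x h, sub_zero] at h5
      simp only [ν, h, if_false]
      rw [h5]
      field_simp
  refine ⟨ν, ?_, hν⟩
  have hφ1 : ContDiff ℝ (⊤ : ℕ∞) (fun p : (Fin n → ℝ) × ℝ => φ p.1) := hφ.comp contDiff_fst
  rw [contDiff_iff_contDiffAt]
  intro p
  by_cases h : φ p.1 = 0
  · have hden : ContDiff ℝ (⊤ : ℕ∞) (fun p : (Fin n → ℝ) × ℝ => p.2 * φ p.1 - 1) :=
      (contDiff_snd.mul hφ1).sub contDiff_const
    have hne : p.2 * φ p.1 - 1 ≠ 0 := by simp [h]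
    refine (hf.contDiffAt.div hden.contDiffAt hne).congr_of_eventuallyEq ?_
    filter_upwards [hden.continuous.continuousAt.eventually_ne hne] with q hq
    rw [Pi.div_apply, eq_div_iff hq]
    exact (hν q.1 q.2).symm
  · have hinv := hφ1.contDiffAt.inv h (x := p)
    refine (hinv.mul (hG.contDiffAt.comp p
      (contDiffAt_fst.prodMk (hinv.prodMk contDiffAt_snd)))).congr_of_eventuallyEq ?_
    filter_upwards [hφ1.continuous.continuousAt.eventually_ne h] with q hq
    simp [ν, hq]
end

section
/- For every ideal I of C^∞(ℝⁿ), the set ∞√I := {g ∈ C^∞(ℝⁿ) : ∃ h ∈ I with Z(g) = Z(h)} is an ideal of C^∞(ℝⁿ) and I ⊆ ∞√I. -/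
/-- The ring `C^∞(ℝⁿ)` of smooth real-valued functions on `ℝⁿ`, as a subring of all functions. -/
def smoothRing (n : ℕ) : Subring ((Fin n → ℝ) → ℝ) where
  carrier := {f | ContDiff ℝ (⊤ : ℕ∞) f}
  mul_mem' := fun {f g} (hf : ContDiff ℝ (⊤ : ℕ∞) f) (hg : ContDiff ℝ (⊤ : ℕ∞) g) => hf.mul hg
  add_mem' := fun {f g} (hf : ContDiff ℝ (⊤ : ℕ∞) f) (hg : ContDiff ℝ (⊤ : ℕ∞) g) => hf.add hg
  one_mem' := show ContDiff ℝ (⊤ : ℕ∞) (fun _ => (1 : ℝ)) from contDiff_const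
  zero_mem' := show ContDiff ℝ (⊤ : ℕ∞) (fun _ => (0 : ℝ)) from contDiff_const
  neg_mem' := fun {f} (hf : ContDiff ℝ (⊤ : ℕ∞) f) => hf.neg

/-- The zero set `Z(f) = {x ∈ ℝⁿ | f x = 0}` of a smooth function. -/
def zeroSet {n : ℕ} (f : smoothRing n) : Set (Fin n → ℝ) :=
  {x | (f : (Fin n → ℝ) → ℝ) x = 0}

/-- The C∞-radical `∞√I = {g : ∃ h ∈ I, Z(g) = Z(h)}` of an ideal `I` of `C^∞(ℝⁿ)` is an
ideal containing `I`. -/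
theorem cinftyRadical_isIdeal (n : ℕ) (I : Ideal (smoothRing n)) :
    ∃ J : Ideal (smoothRing n),
      (J : Set (smoothRing n)) = {g : smoothRing n | ∃ h ∈ I, zeroSet g = zeroSet h} ∧
      I ≤ J := by
  refine ⟨{ carrier := {g | ∃ h ∈ I, zeroSet g = zeroSet h}
            add_mem' := ?_
            zero_mem' := ⟨0, I.zero_mem, rfl⟩
            smul_mem' := ?_ }, rfl, fun g hg => ⟨g, hg, rfl⟩⟩
  · rintro g₁ g₂ ⟨h₁, hI₁, e₁⟩ ⟨h₂, hI₂, e₂⟩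
    refine ⟨(g₁ + g₂) * (h₁ * h₁ + h₂ * h₂), I.mul_mem_left _
      (I.add_mem (I.mul_mem_left _ hI₁) (I.mul_mem_left _ hI₂)), ?_⟩
    ext x
    have a₁ : g₁.1 x = 0 ↔ h₁.1 x = 0 := Set.ext_iff.1 e₁ x
    have a₂ : g₂.1 x = 0 ↔ h₂.1 x = 0 := Set.ext_iff.1 e₂ x
    change g₁.1 x + g₂.1 x = 0 ↔
      (g₁.1 x + g₂.1 x) * (h₁.1 x * h₁.1 x + h₂.1 x * h₂.1 x) = 0
    constructor
    · intro h
      rw [h, zero_mul]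
    · intro h
      rcases mul_eq_zero.1 h with h | h
      · exact h
      · have b₁ : h₁.1 x = 0 := by
          nlinarith [mul_self_nonneg (h₁.1 x), mul_self_nonneg (h₂.1 x)]
        have b₂ : h₂.1 x = 0 := by
          nlinarith [mul_self_nonneg (h₁.1 x), mul_self_nonneg (h₂.1 x)]
        rw [a₁.2 b₁, a₂.2 b₂, add_zero]
  · rintro c g ⟨h, hI, e⟩
    refine ⟨c * h, I.mul_mem_left _ hI, ?_⟩
    ext x
    have a : g.1 x = 0 ↔ h.1 x = 0 := Set.ext_iff.1 e x
    change c.1 x * g.1 x = 0 ↔ c.1 x * h.1 x = 0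
    rw [mul_eq_zero, mul_eq_zero, a]
end

section
/- Let I be a finitely generated C∞-radical ideal of C^∞(ℝⁿ). Then 1 ∈ I if and only if Z(I) := ⋂_{f ∈ I} Z(f) = ∅ (a weak Nullstellensatz for C^∞(ℝⁿ)). -/
/-- Weak Nullstellensatz for `C^∞(ℝⁿ)`: a finitely generated C∞-radical ideal `I` contains `1`
iff its common zero set `Z(I) = ⋂_{f ∈ I} Z(f)` is empty. -/
theorem weak_nullstellensatz (n : ℕ) (I : Ideal (smoothRing n)) (hfg : I.FG)
    (hrad : {g : smoothRing n | ∃ h ∈ I, zeroSet g = zeroSet h} = (I : Set (smoothRing n))) :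
    (1 : smoothRing n) ∈ I ↔ (⋂ f ∈ I, zeroSet f) = (∅ : Set (Fin n → ℝ)) := by
  have hev : ∀ (x : Fin n → ℝ) (S : Finset (smoothRing n)),
      ((∑ f ∈ S, f * f : smoothRing n) : (Fin n → ℝ) → ℝ) x
        = ∑ f ∈ S, (f : (Fin n → ℝ) → ℝ) x * (f : (Fin n → ℝ) → ℝ) x := by
    intro x S
    rw [AddSubmonoidClass.coe_finset_sum, Finset.sum_apply]
    rfl
  constructor
  · intro h1
    apply Set.eq_empty_of_forall_notMem
    intro x hx
    have hx1 : x ∈ zeroSet (1 : smoothRing n) := Set.mem_iInter₂.1 hx 1 h1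
    exact one_ne_zero (α := ℝ) hx1
  · intro hempty
    obtain ⟨S, hS⟩ := hfg
    have hmem : (1 : smoothRing n) ∈ (I : Set (smoothRing n)) := by
      rw [← hrad]
      refine ⟨∑ f ∈ S, f * f, ?_, ?_⟩
      · refine Ideal.sum_mem _ fun f hf => I.mul_mem_left _ ?_
        rw [← hS]
        exact Ideal.subset_span hf
      · have h1 : zeroSet (1 : smoothRing n) = ∅ :=
          Set.eq_empty_of_forall_notMem fun x hx => one_ne_zero (α := ℝ) hx
        rw [h1]
        symm
        apply Set.eq_empty_of_forall_notMem
        intro x hx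
        have hx0 : ((∑ f ∈ S, f * f : smoothRing n) : (Fin n → ℝ) → ℝ) x = 0 := hx
        rw [hev, Finset.sum_eq_zero_iff_of_nonneg (fun f _ => mul_self_nonneg _)] at hx0
        have hle : I ≤ RingHom.ker ((Pi.evalRingHom (fun _ : Fin n → ℝ => ℝ) x).comp
            (smoothRing n).subtype) := by
          rw [← hS, Ideal.span_le]
          intro f hf
          exact mul_self_eq_zero.1 (hx0 f hf)
        have : x ∈ (⋂ f ∈ I, zeroSet f) := Set.mem_iInter₂.2 fun f hf => hle hf
        rw [hempty] at this
        exact this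
    exact hmem
end

section
/- Every maximal ideal m of C^∞(ℝⁿ) is C∞-radical: if g ∈ C^∞(ℝⁿ) and there exists h ∈ m with Z(g) = Z(h), then g ∈ m. -/
/-- Every maximal ideal of `C^∞(ℝⁿ)` is C∞-radical: if `Z(g) = Z(h)` for some `h ∈ m`,
then `g ∈ m`. -/
theorem maximal_is_cinftyRadical (n : ℕ) (m : Ideal (smoothRing n)) (hm : m.IsMaximal)
    (g : smoothRing n) (hg : ∃ h ∈ m, zeroSet g = zeroSet h) : g ∈ m := by
  obtain ⟨h, hh, hz⟩ := hg
  by_contra hgm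
  obtain ⟨a, i, hi, hai⟩ := hm.exists_inv hgm
  have hk : h * h + i * i ∈ m := m.add_mem (m.mul_mem_left h hh) (m.mul_mem_left i hi)
  have hne : ∀ x, ((h * h + i * i : smoothRing n) : (Fin n → ℝ) → ℝ) x ≠ 0 := by
    intro x hx
    have hx' : (h : (Fin n → ℝ) → ℝ) x * (h : (Fin n → ℝ) → ℝ) x
        + (i : (Fin n → ℝ) → ℝ) x * (i : (Fin n → ℝ) → ℝ) x = 0 := hx
    have h0 : (h : (Fin n → ℝ) → ℝ) x = 0 := by nlinarith [mul_self_nonneg ((h : (Fin n → ℝ) → ℝ) x), mul_self_nonneg ((i : (Fin n → ℝ) → ℝ) x)]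
    have i0 : (i : (Fin n → ℝ) → ℝ) x = 0 := by nlinarith [mul_self_nonneg ((h : (Fin n → ℝ) → ℝ) x), mul_self_nonneg ((i : (Fin n → ℝ) → ℝ) x)]
    have g0 : (g : (Fin n → ℝ) → ℝ) x = 0 := by
      have : x ∈ zeroSet g := by rw [hz]; exact h0
      exact this
    have h1 : (a : (Fin n → ℝ) → ℝ) x * (g : (Fin n → ℝ) → ℝ) x
        + (i : (Fin n → ℝ) → ℝ) x = 1 :=
      congrFun (congrArg (fun f : smoothRing n => (f : (Fin n → ℝ) → ℝ)) hai) x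
    rw [g0, i0] at h1
    norm_num at h1
  have hsm : ContDiff ℝ (⊤ : ℕ∞) ((h * h + i * i : smoothRing n) : (Fin n → ℝ) → ℝ) :=
    (h * h + i * i : smoothRing n).2
  let u : smoothRing n :=
    ⟨fun x => (((h * h + i * i : smoothRing n) : (Fin n → ℝ) → ℝ) x)⁻¹, hsm.inv hne⟩
  have hu : u * (h * h + i * i) = 1 := by
    apply Subtype.ext
    funext x
    exact inv_mul_cancel₀ (hne x)
  exact hm.ne_top ((Ideal.eq_top_iff_one m).2 (hu ▸ m.mul_mem_left u hk))
end

section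
/- Let F be a proper filter of closed subsets of ℝⁿ that is maximal among proper filters of closed subsets of ℝⁿ with respect to inclusion (i.e. whenever F' is a proper filter of closed subsets with F ⊆ F', then F' = F). Then F̌ := {f ∈ C^∞(ℝⁿ) : Z(f) ∈ F} is a maximal ideal of C^∞(ℝⁿ). -/
/-- A filter of closed subsets of `ℝⁿ`: a collection of closed sets containing `ℝⁿ`,
closed under binary intersection, and upward closed among closed sets. -/
def IsClosedSetsFilter (n : ℕ) (F : Set (Set (Fin n → ℝ))) : Prop :=
  (∀ A ∈ F, IsClosed A) ∧ Set.univ ∈ F ∧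
    (∀ A ∈ F, ∀ B ∈ F, A ∩ B ∈ F) ∧
    (∀ A ∈ F, ∀ B : Set (Fin n → ℝ), IsClosed B → A ⊆ B → B ∈ F)

/-- If `F` is a maximal proper filter of closed subsets of `ℝⁿ`, then
`F̌ = {f ∈ C^∞(ℝⁿ) : Z(f) ∈ F}` is a maximal ideal of `C^∞(ℝⁿ)`. -/
theorem checkFilter_maximal (n : ℕ) (F : Set (Set (Fin n → ℝ)))
    (hF : IsClosedSetsFilter n F) (hproper : (∅ : Set (Fin n → ℝ)) ∉ F)
    (hmax : ∀ F' : Set (Set (Fin n → ℝ)), IsClosedSetsFilter n F' →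
      (∅ : Set (Fin n → ℝ)) ∉ F' → F ⊆ F' → F' = F) :
    ∃ J : Ideal (smoothRing n),
      (J : Set (smoothRing n)) = {f : smoothRing n | zeroSet f ∈ F} ∧ J.IsMaximal := by
  obtain ⟨hcl, huniv, hinter, hup⟩ := hF
  have hzc : ∀ f : smoothRing n, IsClosed (zeroSet f) := fun f =>
    isClosed_eq (ContDiff.continuous (n := ((⊤ : ℕ∞) : WithTop ℕ∞)) (𝕜 := ℝ) f.2)
      continuous_const
  let J : Ideal (smoothRing n) :=
    { carrier := {f : smoothRing n | zeroSet f ∈ F}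
      add_mem' := by
        intro f g hf hg
        refine hup _ (hinter _ hf _ hg) _ (hzc _) ?_
        rintro x ⟨h1, h2⟩
        have h1' : f.1 x = 0 := h1
        have h2' : g.1 x = 0 := h2
        change f.1 x + g.1 x = 0
        rw [h1', h2', add_zero]
      zero_mem' := by
        refine hup _ huniv _ (hzc _) ?_
        intro x _
        rfl
      smul_mem' := by
        intro c f hf
        refine hup _ hf _ (hzc _) ?_
        intro x h1
        have h1' : f.1 x = 0 := h1
        change c.1 x * f.1 x = 0
        rw [h1', mul_zero] }
  refine ⟨J, rfl, ?_⟩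
  rw [Ideal.isMaximal_iff]
  constructor
  · intro h
    have h' : zeroSet (1 : smoothRing n) ∈ F := h
    have : zeroSet (1 : smoothRing n) = ∅ := by
      ext x
      constructor
      · intro hx
        have hx' : (1 : ℝ) = 0 := hx
        exact absurd hx' one_ne_zero
      · intro hx
        exact hx.elim
    rw [this] at h'
    exact hproper h'
  · intro J' f hJ hf hfJ'
    have hf' : zeroSet f ∉ F := hf
    obtain ⟨A, hA, hAf⟩ : ∃ A ∈ F, A ∩ zeroSet f = ∅ := by
      by_contra hcon
      push Not at hcon
      apply hf'
      have key := hmax {B | IsClosed B ∧ ∃ A ∈ F, A ∩ zeroSet f ⊆ B} ?_ ?_ ?_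
      · rw [← key]
        exact ⟨hzc f, Set.univ, huniv, Set.inter_subset_right⟩
      · refine ⟨fun A h => h.1, ⟨isClosed_univ, Set.univ, huniv, Set.subset_univ _⟩, ?_, ?_⟩
        · rintro B ⟨hB, A, hA, hAB⟩ C ⟨hC, D, hD, hDC⟩
          exact ⟨hB.inter hC, A ∩ D, hinter _ hA _ hD,
            fun x hx => ⟨hAB ⟨hx.1.1, hx.2⟩, hDC ⟨hx.1.2, hx.2⟩⟩⟩
        · rintro B ⟨hB, A, hA, hAB⟩ C hC hBC
          exact ⟨hC, A, hA, hAB.trans hBC⟩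
      · rintro ⟨-, A, hA, hAB⟩
        have h := hcon A hA
        rw [Set.subset_empty_iff.mp hAB] at h
        exact Set.not_nonempty_empty h
      · intro A hA
        exact ⟨hcl A hA, A, hA, Set.inter_subset_left⟩
    obtain ⟨g, hgs, hgd, -⟩ :=
      (hcl A hA).isOpen_compl.exists_contDiff_support_eq (n := (⊤ : ℕ∞))
    let G : smoothRing n := ⟨g, hgd⟩
    have hgz : ∀ x, g x = 0 ↔ x ∈ A := by
      intro x
      have h : x ∈ Function.support g ↔ x ∈ Aᶜ := by rw [hgs]
      rw [Function.mem_support, Set.mem_compl_iff] at h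
      exact not_iff_not.mp h
    have hGJ : G ∈ J' := by
      apply hJ
      change zeroSet G ∈ F
      have : zeroSet G = A := by
        ext x
        exact hgz x
      rw [this]
      exact hA
    have hne : ∀ x, f.1 x * f.1 x + g x * g x ≠ 0 := by
      intro x hx
      have h1 : f.1 x = 0 := by nlinarith [mul_self_nonneg (f.1 x), mul_self_nonneg (g x)]
      have h2 : g x = 0 := by nlinarith [mul_self_nonneg (f.1 x), mul_self_nonneg (g x)]
      have h3 : x ∈ A ∩ zeroSet f := ⟨(hgz x).1 h2, h1⟩
      rw [hAf] at h3
      exact h3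
    have hfd : ContDiff ℝ (⊤ : ℕ∞) f.1 := f.2
    let K : smoothRing n := ⟨fun x => (f.1 x * f.1 x + g x * g x)⁻¹,
      ContDiff.inv ((hfd.mul hfd).add (hgd.mul hgd)) hne⟩
    have h1 : (1 : smoothRing n) = K * (f * f + G * G) := by
      apply Subtype.ext
      funext x
      exact (inv_mul_cancel₀ (hne x)).symm
    rw [h1]
    exact J'.mul_mem_left _ (J'.add_mem (J'.mul_mem_left _ hfJ') (J'.mul_mem_left _ hGJ))
end

section
/- Let I be a prime ideal of C^∞(ℝⁿ). If F and G are closed subsets of ℝⁿ such that F ∪ G = Z(h) for some h ∈ I, then there exists f ∈ I with Z(f) = F, or there exists g ∈ I with Z(g) = G. (That is, the filter Î = {Z(f) : f ∈ I} of closed subsets of ℝⁿ is a prime filter.) -/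
theorem exists_smooth_zero {n : ℕ} {F : Set (Fin n → ℝ)} (hF : IsClosed F) :
    ∃ f : smoothRing n, zeroSet f = F ∧ ∀ x, 0 ≤ (f : (Fin n → ℝ) → ℝ) x := by
  obtain ⟨f, hs, hf, hr⟩ := hF.isOpen_compl.exists_contDiff_support_eq (n := (⊤ : ℕ∞))
  refine ⟨⟨f, hf⟩, ?_, fun x => (hr (Set.mem_range_self x)).1⟩
  ext x
  have h1 : x ∈ Function.support f ↔ x ∈ Fᶜ := by rw [hs]
  simp only [Function.mem_support, Set.mem_compl_iff] at h1
  exact not_iff_not.mp h1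

/-- For a prime ideal `I` of `C^∞(ℝⁿ)`, the filter `Î = {Z(f) : f ∈ I}` is prime: if the
union of two closed sets `F ∪ G` is the zero set of some element of `I`, then `F` or `G`
is the zero set of some element of `I`. -/
theorem idealZeroSets_prime (n : ℕ) (I : Ideal (smoothRing n)) (hI : I.IsPrime)
    (F G : Set (Fin n → ℝ)) (hF : IsClosed F) (hG : IsClosed G)
    (hFG : ∃ h ∈ I, F ∪ G = zeroSet h) :
    (∃ f ∈ I, zeroSet f = F) ∨ (∃ g ∈ I, zeroSet g = G) := by
  obtain ⟨h, hh, hZ⟩ := hFG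
  obtain ⟨u, hu, hu0⟩ := exists_smooth_zero hF
  obtain ⟨v, hv, hv0⟩ := exists_smooth_zero hG
  have cu : Continuous (u : (Fin n → ℝ) → ℝ) := (show ContDiff ℝ (⊤ : ℕ∞) u.1 from u.2).continuous
  have cv : Continuous (v : (Fin n → ℝ) → ℝ) := (show ContDiff ℝ (⊤ : ℕ∞) v.1 from v.2).continuous
  obtain ⟨a, ha, ha0⟩ := exists_smooth_zero (isClosed_le cu cv)
  obtain ⟨b, hb, hb0⟩ := exists_smooth_zero (isClosed_le cv cu)
  have eF : ∀ x, u.1 x = 0 ↔ x ∈ F := fun x => Set.ext_iff.mp hu x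
  have eG : ∀ x, v.1 x = 0 ↔ x ∈ G := fun x => Set.ext_iff.mp hv x
  have eh : ∀ x, (x ∈ F ∨ x ∈ G) ↔ h.1 x = 0 := fun x => Set.ext_iff.mp hZ x
  have ea : ∀ x, a.1 x = 0 ↔ u.1 x ≤ v.1 x := fun x => Set.ext_iff.mp ha x
  have eb : ∀ x, b.1 x = 0 ↔ v.1 x ≤ u.1 x := fun x => Set.ext_iff.mp hb x
  have hab : a * b = 0 := by
    apply Subtype.ext
    funext x
    change a.1 x * b.1 x = 0
    rcases le_total (u.1 x) (v.1 x) with h1 | h1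
    · rw [(ea x).2 h1, zero_mul]
    · rw [(eb x).2 h1, mul_zero]
  have key : ∀ c : smoothRing n, (∀ x, 0 ≤ c.1 x) → ∀ x,
      (x ∈ zeroSet (h * h + c) ↔ h.1 x = 0 ∧ c.1 x = 0) := by
    intro c hc x
    change h.1 x * h.1 x + c.1 x = 0 ↔ _
    rw [add_eq_zero_iff_of_nonneg (mul_self_nonneg _) (hc x), mul_self_eq_zero]
  have hm : (h * h + a) * (h * h + b) ∈ I := by
    have e : (h * h + a) * (h * h + b) = (h * (h * h + a + b)) * h := by
      linear_combination hab
    rw [e]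
    exact I.mul_mem_left _ hh
  rcases hI.mem_or_mem hm with h1 | h1
  · refine Or.inl ⟨_, h1, ?_⟩
    ext x
    rw [key a ha0, ← eh, ea, ← eF, ← eG]
    have := hu0 x
    have := hv0 x
    constructor
    · rintro ⟨h2 | h2, h3⟩ <;> linarith
    · intro h2
      exact ⟨Or.inl h2, by linarith⟩
  · refine Or.inr ⟨_, h1, ?_⟩
    ext x
    rw [key b hb0, ← eh, eb, ← eF, ← eG]
    have := hu0 x
    have := hv0 x
    constructor
    · rintro ⟨h2 | h2, h3⟩ <;> linarith
    · intro h2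
      exact ⟨Or.inr h2, by linarith⟩
end

section
/- Let F be a proper filter of closed subsets of ℝⁿ that is prime, i.e. for all closed A, B ⊆ ℝⁿ, if A ∪ B ∈ F then A ∈ F or B ∈ F. Then F̌ := {f ∈ C^∞(ℝⁿ) : Z(f) ∈ F} is a prime ideal of C^∞(ℝⁿ). -/
/-- If `F` is a proper prime filter of closed subsets of `ℝⁿ`, then
`F̌ = {f ∈ C^∞(ℝⁿ) : Z(f) ∈ F}` is a prime ideal of `C^∞(ℝⁿ)`. -/
theorem checkFilter_prime (n : ℕ) (F : Set (Set (Fin n → ℝ)))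
    (hF : IsClosedSetsFilter n F) (hproper : (∅ : Set (Fin n → ℝ)) ∉ F)
    (hprime : ∀ A B : Set (Fin n → ℝ), IsClosed A → IsClosed B → A ∪ B ∈ F → A ∈ F ∨ B ∈ F) :
    ∃ J : Ideal (smoothRing n),
      (J : Set (smoothRing n)) = {f : smoothRing n | zeroSet f ∈ F} ∧ J.IsPrime := by
  obtain ⟨-, huniv, hinter, hup⟩ := hF
  have hcl : ∀ f : smoothRing n, IsClosed (zeroSet f) := fun f => by
    have hf : ContDiff ℝ (⊤ : ℕ∞) (f : (Fin n → ℝ) → ℝ) := f.2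
    exact isClosed_eq hf.continuous continuous_const
  let J : Ideal (smoothRing n) :=
    { carrier := {f : smoothRing n | zeroSet f ∈ F}
      add_mem' := by
        intro f g hf hg
        refine hup _ (hinter _ hf _ hg) _ (hcl _) ?_
        rintro x ⟨hx, hy⟩
        simp only [zeroSet, Set.mem_setOf_eq] at hx hy ⊢
        simp [hx, hy]
      zero_mem' := by
        refine hup _ huniv _ (hcl _) ?_
        intro x _
        simp [zeroSet]
      smul_mem' := by
        intro c f hf
        refine hup _ hf _ (hcl _) ?_
        intro x hx
        simp only [zeroSet, Set.mem_setOf_eq] at hx ⊢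
        simp [hx] }
  have hJ : ∀ f, f ∈ J ↔ zeroSet f ∈ F := fun f => Iff.rfl
  refine ⟨J, rfl, ?_⟩
  refine Ideal.isPrime_iff.2 ⟨?_, ?_⟩
  · rw [Ideal.ne_top_iff_one, hJ]
    have h1 : zeroSet (1 : smoothRing n) = ∅ := by
      ext x
      simp [zeroSet]
    rwa [h1]
  · intro f g h
    rw [hJ] at h
    have h2 : zeroSet (f * g) = zeroSet f ∪ zeroSet g := by
      ext x
      simp [zeroSet]
    rw [h2] at h
    exact hprime _ _ (hcl f) (hcl g) h
end

section
/- If p is a prime ideal of C^∞(ℝⁿ), then its C∞-radical ∞√p := {g ∈ C^∞(ℝⁿ) : ∃ h ∈ p with Z(g) = Z(h)} is a prime ideal of C^∞(ℝⁿ). -/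
theorem mem_rad_iff {n : ℕ} (p : Ideal (smoothRing n)) (g : smoothRing n) :
    (∃ h ∈ p, zeroSet g = zeroSet h) ↔
      ∃ h ∈ p, ∀ x, (h : (Fin n → ℝ) → ℝ) x = 0 → (g : (Fin n → ℝ) → ℝ) x = 0 := by
  constructor
  · rintro ⟨h, hh, e⟩
    refine ⟨h, hh, fun x hx => ?_⟩
    have : x ∈ zeroSet h := hx
    rw [← e] at this
    exact this
  · rintro ⟨h, hh, H⟩
    refine ⟨g * h, p.mul_mem_left g hh, ?_⟩
    ext x
    change g.1 x = 0 ↔ g.1 x * h.1 x = 0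
    rw [mul_eq_zero]
    constructor
    · exact Or.inl
    · rintro (h1 | h1)
      · exact h1
      · exact H x h1

theorem sq_add_mem {n : ℕ} (p : Ideal (smoothRing n)) {a b : smoothRing n} (ha : a ∈ p)
    (hb : b ∈ p) : ∃ c ∈ p, ∀ x, c.1 x = 0 → a.1 x = 0 ∧ b.1 x = 0 := by
  refine ⟨a * a + b * b, p.add_mem (p.mul_mem_left _ ha) (p.mul_mem_left _ hb), fun x hx => ?_⟩
  change a.1 x * a.1 x + b.1 x * b.1 x = 0 at hx
  constructor <;> nlinarith [mul_self_nonneg (a.1 x), mul_self_nonneg (b.1 x)]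

theorem exists_pos_part {n : ℕ} (f : smoothRing n) :
    ∃ u : smoothRing n, ∀ x, u.1 x = 0 ↔ f.1 x ≤ 0 :=
  ⟨⟨fun x => expNegInvGlue (f.1 x), expNegInvGlue.contDiff.comp f.2⟩,
    fun _ => expNegInvGlue.zero_iff_nonpos⟩

/-- The C∞-radical of a prime ideal of `C^∞(ℝⁿ)` is a prime ideal. -/
theorem cinftyRadical_of_prime_isPrime (n : ℕ) (p : Ideal (smoothRing n)) (hp : p.IsPrime) :
    ∃ J : Ideal (smoothRing n),
      (J : Set (smoothRing n)) = {g : smoothRing n | ∃ h ∈ p, zeroSet g = zeroSet h} ∧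
      J.IsPrime := by
  have key : ∀ f g u h : smoothRing n, u ∈ p → h ∈ p →
      (∀ x, h.1 x = 0 → f.1 x * g.1 x = 0) →
      (∀ x, u.1 x = 0 ↔ f.1 x * f.1 x - g.1 x * g.1 x ≤ 0) →
      ∃ h ∈ p, ∀ x, h.1 x = 0 → f.1 x = 0 := by
    intro f g u h hu hh H1 H2
    obtain ⟨c, hc, H⟩ := sq_add_mem p hu hh
    refine ⟨c, hc, fun x hx => ?_⟩
    obtain ⟨h1, h2⟩ := H x hx
    have h3 := (H2 x).1 h1
    rcases mul_eq_zero.1 (H1 x h2) with h4 | h4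
    · exact h4
    · rw [h4] at h3
      nlinarith [mul_self_nonneg (f.1 x)]
  refine ⟨{ carrier := {g : smoothRing n | ∃ h ∈ p, zeroSet g = zeroSet h}
            add_mem' := ?_
            zero_mem' := ⟨0, p.zero_mem, rfl⟩
            smul_mem' := ?_ }, rfl, ?_, ?_⟩
  · intro a b ha hb
    simp only [Set.mem_setOf_eq, mem_rad_iff] at ha hb ⊢
    obtain ⟨h, hh, H⟩ := ha
    obtain ⟨k, hk, K⟩ := hb
    obtain ⟨c, hc, C⟩ := sq_add_mem p hh hk
    refine ⟨c, hc, fun x hx => ?_⟩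
    change a.1 x + b.1 x = 0
    rw [H x (C x hx).1, K x (C x hx).2, add_zero]
  · intro a b hb
    simp only [Set.mem_setOf_eq, mem_rad_iff] at hb ⊢
    obtain ⟨h, hh, H⟩ := hb
    refine ⟨h, hh, fun x hx => ?_⟩
    change a.1 x * b.1 x = 0
    rw [H x hx, mul_zero]
  · rw [Ideal.ne_top_iff_one]
    intro h1
    obtain ⟨h, hh, H⟩ := (mem_rad_iff p 1).1 h1
    have hne : ∀ x, h.1 x ≠ 0 := fun x hx => one_ne_zero (α := ℝ) (H x hx)
    apply hp.ne_top
    rw [Ideal.eq_top_iff_one]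
    have hi : ContDiff ℝ (⊤ : ℕ∞) (fun x => (h.1 x)⁻¹) := ContDiff.inv h.2 hne
    have e : (⟨fun x => (h.1 x)⁻¹, hi⟩ : smoothRing n) * h = 1 := by
      apply Subtype.ext
      funext x
      exact inv_mul_cancel₀ (hne x)
    rw [← e]
    exact p.mul_mem_left _ hh
  · intro f g hfg
    obtain ⟨h, hh, H⟩ := (mem_rad_iff p (f * g)).1 hfg
    replace H : ∀ x, h.1 x = 0 → f.1 x * g.1 x = 0 := H
    obtain ⟨u, hu⟩ := exists_pos_part (f * f - g * g)
    obtain ⟨v, hv⟩ := exists_pos_part (g * g - f * f)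
    replace hu : ∀ x, u.1 x = 0 ↔ f.1 x * f.1 x - g.1 x * g.1 x ≤ 0 := hu
    replace hv : ∀ x, v.1 x = 0 ↔ g.1 x * g.1 x - f.1 x * f.1 x ≤ 0 := hv
    have huv : u * v = 0 := by
      apply Subtype.ext
      funext x
      change u.1 x * v.1 x = 0
      rw [mul_eq_zero, hu, hv]
      rcases le_total (f.1 x * f.1 x) (g.1 x * g.1 x) with h1 | h1
      · left; linarith
      · right; linarith
    rcases hp.mem_or_mem (show u * v ∈ p by rw [huv]; exact p.zero_mem) with h1 | h1
    · exact Or.inl ((mem_rad_iff p f).2 (key f g u h h1 hh H hu))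
    · exact Or.inr ((mem_rad_iff p g).2 (key g f v h h1 hh
        (fun x hx => by rw [mul_comm]; exact H x hx) hv))
end

section
/- Let I be an ideal of C^∞(ℝⁿ) and h ∈ C^∞(ℝⁿ). The residue class of h in the quotient ring C^∞(ℝⁿ)/I is a unit if and only if there exists φ ∈ I such that h(x) ≠ 0 for every x ∈ Z(φ). -/
/-- The residue class of `h` in `C^∞(ℝⁿ)/I` is a unit iff there is `φ ∈ I` with
`h x ≠ 0` for every `x ∈ Z(φ)`. -/
theorem quotient_isUnit_iff (n : ℕ) (I : Ideal (smoothRing n)) (h : smoothRing n) :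
    IsUnit (Ideal.Quotient.mk I h) ↔
      ∃ φ ∈ I, ∀ x ∈ zeroSet φ, (h : (Fin n → ℝ) → ℝ) x ≠ 0 := by
  constructor
  · intro hu
    obtain ⟨b, hb⟩ := hu.exists_right_inv
    obtain ⟨g, rfl⟩ := Ideal.Quotient.mk_surjective b
    rw [← map_mul, ← map_one (Ideal.Quotient.mk I), Ideal.Quotient.eq] at hb
    refine ⟨h * g - 1, hb, fun x hx h0 => ?_⟩
    have hx' : (h : (Fin n → ℝ) → ℝ) x * (g : (Fin n → ℝ) → ℝ) x - 1 = 0 := hx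
    rw [h0] at hx'
    norm_num at hx'
  · rintro ⟨φ, hφ, hz⟩
    have hpos : ∀ x, (h : (Fin n → ℝ) → ℝ) x * (h : (Fin n → ℝ) → ℝ) x
        + (φ : (Fin n → ℝ) → ℝ) x * (φ : (Fin n → ℝ) → ℝ) x ≠ 0 := by
      intro x h0
      have h1 : (φ : (Fin n → ℝ) → ℝ) x = 0 := by
        nlinarith [mul_self_nonneg ((h : (Fin n → ℝ) → ℝ) x),
          mul_self_nonneg ((φ : (Fin n → ℝ) → ℝ) x)]
      have h2 := hz x h1
      rw [h1] at h0
      apply h2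
      simpa using h0
    have hh : ContDiff ℝ (⊤ : ℕ∞) (h : (Fin n → ℝ) → ℝ) := h.2
    have hp : ContDiff ℝ (⊤ : ℕ∞) (φ : (Fin n → ℝ) → ℝ) := φ.2
    let v : smoothRing n := ⟨fun x => ((h : (Fin n → ℝ) → ℝ) x * (h : (Fin n → ℝ) → ℝ) x
        + (φ : (Fin n → ℝ) → ℝ) x * (φ : (Fin n → ℝ) → ℝ) x)⁻¹,
        ((hh.mul hh).add (hp.mul hp)).inv hpos⟩
    have hv : (h * h + φ * φ) * v = 1 := by
      apply Subtype.ext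
      funext x
      exact mul_inv_cancel₀ (hpos x)
    refine IsUnit.of_mul_eq_one (Ideal.Quotient.mk I (h * v)) ?_
    rw [← map_mul, ← map_one (Ideal.Quotient.mk I), Ideal.Quotient.eq]
    have : h * (h * v) - 1 = (-(φ * v)) * φ := by
      rw [← hv]; ring
    rw [this]
    exact I.mul_mem_left _ hφ
end

section
/- Let p be a C∞-radical prime ideal of C^∞(ℝⁿ) and define Φ := {U ⊆ ℝⁿ : ∃ f ∈ C^∞(ℝⁿ), f ∉ p and U = {x : f(x) ≠ 0}}. Then Φ is a proper prime filter of open subsets of ℝⁿ: (i) ℝⁿ ∈ Φ; (ii) ∅ ∉ Φ; (iii) if U, V ∈ Φ then U ∩ V ∈ Φ; (iv) if U ∈ Φ, V ⊆ ℝⁿ is open and U ⊆ V, then V ∈ Φ; (v) for all open V, W ⊆ ℝⁿ, if V ∪ W ∈ Φ then V ∈ Φ or W ∈ Φ. -/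
/-- The collection of cozero sets of elements outside a C∞-radical prime ideal `p`. -/
def cozFilter {n : ℕ} (p : Ideal (smoothRing n)) : Set (Set (Fin n → ℝ)) :=
  {U | ∃ f : smoothRing n, f ∉ p ∧ U = {x | (f : (Fin n → ℝ) → ℝ) x ≠ 0}}

theorem exists_coz {n : ℕ} (V : Set (Fin n → ℝ)) (hV : IsOpen V) :
    ∃ g : smoothRing n, (∀ x, 0 ≤ (g : (Fin n → ℝ) → ℝ) x) ∧
      ∀ x, x ∈ V ↔ (g : (Fin n → ℝ) → ℝ) x ≠ 0 := by
  obtain ⟨g, hs, hd, hr⟩ := hV.exists_contDiff_support_eq (n := ⊤)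
  refine ⟨⟨g, hd⟩, fun x => (hr ⟨x, rfl⟩).1, fun x => ?_⟩
  rw [← hs]
  rfl

/-- For a C∞-radical prime ideal `p` of `C^∞(ℝⁿ)`, the collection
`Φ = {U_f : f ∉ p}` of cozero sets is a proper prime filter of open subsets of `ℝⁿ`. -/
theorem cozFilter_proper_prime (n : ℕ) (p : Ideal (smoothRing n)) (hp : p.IsPrime)
    (hrad : ∀ g : smoothRing n, (∃ h ∈ p, zeroSet g = zeroSet h) → g ∈ p) :
    (Set.univ ∈ cozFilter p) ∧
    ((∅ : Set (Fin n → ℝ)) ∉ cozFilter p) ∧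
    (∀ U ∈ cozFilter p, ∀ V ∈ cozFilter p, U ∩ V ∈ cozFilter p) ∧
    (∀ U ∈ cozFilter p, ∀ V : Set (Fin n → ℝ), IsOpen V → U ⊆ V → V ∈ cozFilter p) ∧
    (∀ V W : Set (Fin n → ℝ), IsOpen V → IsOpen W → V ∪ W ∈ cozFilter p →
      V ∈ cozFilter p ∨ W ∈ cozFilter p) := by
  refine ⟨⟨1, fun h => hp.ne_top ((Ideal.eq_top_iff_one p).2 h), ?_⟩, ?_, ?_, ?_, ?_⟩
  · ext x
    simp
  · rintro ⟨f, hf, he⟩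
    have : f = 0 := by
      ext x
      by_contra hx
      have : x ∈ (∅ : Set (Fin n → ℝ)) := by
        rw [he]
        exact hx
      exact this
    exact hf (this ▸ p.zero_mem)
  · rintro _ ⟨f, hf, rfl⟩ _ ⟨g, hg, rfl⟩
    refine ⟨f * g, fun h => (hp.mem_or_mem h).elim hf hg, ?_⟩
    ext x
    simp
  · rintro _ ⟨f, hf, rfl⟩ V hV hUV
    obtain ⟨g, -, hg⟩ := exists_coz V hV
    refine ⟨g, fun h => hf (hrad f ⟨f * g, p.mul_mem_left f h, ?_⟩), Set.ext hg⟩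
    ext x
    have h1 : (f : (Fin n → ℝ) → ℝ) x ≠ 0 → (g : (Fin n → ℝ) → ℝ) x ≠ 0 :=
      fun hx => (hg x).1 (hUV hx)
    simp only [zeroSet, Set.mem_setOf_eq, Subring.coe_mul, Pi.mul_apply, mul_eq_zero]
    tauto
  · rintro V W hV hW ⟨f, hf, he⟩
    obtain ⟨v, hv0, hv⟩ := exists_coz V hV
    obtain ⟨w, hw0, hw⟩ := exists_coz W hW
    by_cases h1 : v ∈ p
    · by_cases h2 : w ∈ p
      · refine absurd (hrad f ⟨v + w, p.add_mem h1 h2, ?_⟩) hf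
        ext x
        have h3 := Set.ext_iff.1 he x
        rw [Set.mem_union, hv, hw, Set.mem_setOf_eq] at h3
        simp only [zeroSet, Set.mem_setOf_eq, Subring.coe_add, Pi.add_apply,
          add_eq_zero_iff_of_nonneg (hv0 x) (hw0 x)]
        tauto
      · exact Or.inr ⟨w, h2, Set.ext hw⟩
    · exact Or.inl ⟨v, h1, Set.ext hv⟩
end

section
/- For every ideal I of C^∞(ℝⁿ), the C∞-radical ∞√I equals the intersection of all C∞-radical prime ideals of C^∞(ℝⁿ) containing I: ∞√I = ⋂ {p : p is a prime ideal of C^∞(ℝⁿ), p is C∞-radical, and I ⊆ p}. -/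
theorem mem_zeroSet_iff' {n : ℕ} (f : smoothRing n) (x : Fin n → ℝ) :
    x ∈ zeroSet f ↔ (f : (Fin n → ℝ) → ℝ) x = 0 := Iff.rfl

theorem zeroSet_mul' {n : ℕ} (f g : smoothRing n) :
    zeroSet (f * g) = zeroSet f ∪ zeroSet g := by
  ext x
  simp [mem_zeroSet_iff']

/-- The C∞-radical as an ideal. -/
def cinfRad {n : ℕ} (I : Ideal (smoothRing n)) : Ideal (smoothRing n) where
  carrier := {g | ∃ h ∈ I, zeroSet h ⊆ zeroSet g}
  zero_mem' := ⟨0, I.zero_mem, subset_rfl⟩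
  add_mem' := by
    rintro a b ⟨h, hI, hh⟩ ⟨k, kI, hk⟩
    refine ⟨h * h + k * k, I.add_mem (I.mul_mem_left _ hI) (I.mul_mem_left _ kI), ?_⟩
    intro x hx
    have hx' : (h : (Fin n → ℝ) → ℝ) x * (h : (Fin n → ℝ) → ℝ) x
        + (k : (Fin n → ℝ) → ℝ) x * (k : (Fin n → ℝ) → ℝ) x = 0 := hx
    have h1 : (h : (Fin n → ℝ) → ℝ) x = 0 := by nlinarith [mul_self_nonneg ((h : (Fin n → ℝ) → ℝ) x), mul_self_nonneg ((k : (Fin n → ℝ) → ℝ) x)]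
    have h2 : (k : (Fin n → ℝ) → ℝ) x = 0 := by nlinarith [mul_self_nonneg ((h : (Fin n → ℝ) → ℝ) x), mul_self_nonneg ((k : (Fin n → ℝ) → ℝ) x)]
    have h3 : (a : (Fin n → ℝ) → ℝ) x = 0 := hh h1
    have h4 : (b : (Fin n → ℝ) → ℝ) x = 0 := hk h2
    change (a : (Fin n → ℝ) → ℝ) x + (b : (Fin n → ℝ) → ℝ) x = 0
    rw [h3, h4, add_zero]
  smul_mem' := by
    rintro c a ⟨h, hI, hh⟩
    refine ⟨h, hI, ?_⟩
    rw [smul_eq_mul, zeroSet_mul']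
    exact hh.trans Set.subset_union_right

theorem exists_zeroSet_eq {n : ℕ} (I : Ideal (smoothRing n)) (g h : smoothRing n) (hI : h ∈ I)
    (hh : zeroSet h ⊆ zeroSet g) : ∃ k ∈ I, zeroSet g = zeroSet k :=
  ⟨g * h, I.mul_mem_left _ hI, by rw [zeroSet_mul', Set.union_eq_left.mpr hh]⟩

/-- The functions whose zero set lies in that of `g`. -/
def zSub {n : ℕ} (g : smoothRing n) : Submonoid (smoothRing n) where
  carrier := {f | zeroSet f ⊆ zeroSet g}
  one_mem' := fun x hx => absurd (show (1 : ℝ) = 0 from hx) one_ne_zero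
  mul_mem' := by
    intro a b ha hb
    change zeroSet (a * b) ⊆ _
    rw [zeroSet_mul']
    exact Set.union_subset ha hb

/-- The C∞-radical of an ideal `I` of `C^∞(ℝⁿ)` is the intersection of all C∞-radical prime
ideals containing `I`. -/
theorem cinftyRadical_eq_iInter_primes (n : ℕ) (I : Ideal (smoothRing n)) :
    {g : smoothRing n | ∃ h ∈ I, zeroSet g = zeroSet h} =
      ⋂ p ∈ {p : Ideal (smoothRing n) | p.IsPrime ∧
          (∀ g : smoothRing n, (∃ h ∈ p, zeroSet g = zeroSet h) → g ∈ p) ∧ I ≤ p},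
        (p : Set (smoothRing n)) := by
  apply Set.Subset.antisymm
  · rintro g ⟨h, hI, hh⟩
    refine Set.mem_iInter₂.mpr ?_
    rintro p ⟨_, hp, hIp⟩
    exact hp g ⟨h, hIp hI, hh⟩
  · intro g hg
    by_contra hcon
    have disj : Disjoint (I : Set (smoothRing n)) (zSub g) :=
      Set.disjoint_left.mpr fun f hf hfg => hcon (exists_zeroSet_eq I g f hf hfg)
    have ⟨p, hIp, hp⟩ := zorn_le_nonempty₀
      {p : Ideal (smoothRing n) | Disjoint (p : Set (smoothRing n)) (zSub g)}
      (fun c hc hc' x hx ↦ by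
        have : Nonempty c := ⟨⟨x, hx⟩⟩
        refine ⟨sSup c, Set.disjoint_left.mpr fun x hx ↦ ?_, fun _ ↦ le_sSup⟩
        have ⟨p, hp⟩ := (Submodule.mem_iSup_of_directed _ hc'.directed).mp (sSup_eq_iSup' c ▸ hx)
        exact Set.disjoint_left.mp (hc p.2) hp) I disj
    have hprime : p.IsPrime :=
      Ideal.isPrime_of_maximally_disjoint _ _ hp.1 (fun _ ↦ hp.not_prop_of_gt)
    have hrad : cinfRad p ≤ p := by
      refine hp.2 ?_ fun f hf => ⟨f, hf, subset_rfl⟩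
      refine Set.disjoint_left.mpr ?_
      rintro f ⟨h, hhp, hh⟩ hfg
      exact Set.disjoint_left.mp hp.1 hhp (hh.trans hfg)
    have hgp : g ∈ p := Set.mem_iInter₂.mp hg p
      ⟨hprime, fun f ⟨h, hhp, hh⟩ => hrad ⟨h, hhp, hh.ge⟩, hIp⟩
    exact Set.disjoint_left.mp hp.1 hgp (subset_rfl : zeroSet g ⊆ zeroSet g)
end

section
/- Every proper ideal I of C^∞(ℝⁿ) is contained in some C∞-radical prime ideal: there exists a prime ideal p of C^∞(ℝⁿ) with I ⊆ p and such that whenever Z(g) = Z(h) for some h ∈ p, then g ∈ p. -/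
/-- Every proper ideal of `C^∞(ℝⁿ)` is contained in some C∞-radical prime ideal. -/
theorem exists_cinftyRadical_prime_of_ne_top (n : ℕ) (I : Ideal (smoothRing n))
    (hI : I ≠ ⊤) :
    ∃ p : Ideal (smoothRing n), p.IsPrime ∧ I ≤ p ∧
      ∀ g : smoothRing n, (∃ h ∈ p, zeroSet g = zeroSet h) → g ∈ p := by
  obtain ⟨m, hm, hIm⟩ := Ideal.exists_le_maximal I hI
  refine ⟨m, hm.isPrime, hIm, ?_⟩
  rintro g ⟨h, hh, hz⟩
  by_contra hg
  obtain ⟨a, ha⟩ := hm.exists_inv hg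
  obtain ⟨b, hb, hab⟩ := ha
  have hk : b * b + h * h ∈ m := m.add_mem (m.mul_mem_left _ hb) (m.mul_mem_left _ hh)
  have hne : ∀ x, ((b * b + h * h : smoothRing n) : (Fin n → ℝ) → ℝ) x ≠ 0 := by
    intro x hx
    have hx' : b.1 x * b.1 x + h.1 x * h.1 x = 0 := hx
    have hbx : b.1 x = 0 := by nlinarith [mul_self_nonneg (b.1 x), mul_self_nonneg (h.1 x)]
    have hhx : h.1 x = 0 := by nlinarith [mul_self_nonneg (b.1 x), mul_self_nonneg (h.1 x)]
    have hgx : g.1 x = 0 := by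
      have : x ∈ zeroSet h := hhx
      rw [← hz] at this
      exact this
    have h1 : a.1 x * g.1 x + b.1 x = 1 := congrFun (congrArg Subtype.val hab) x
    rw [hbx, hgx] at h1
    norm_num at h1
  have hs : ContDiff ℝ (⊤ : ℕ∞) ((b * b + h * h : smoothRing n) : (Fin n → ℝ) → ℝ) :=
    (b * b + h * h : smoothRing n).2
  let u : smoothRing n :=
    ⟨fun x => (((b * b + h * h : smoothRing n) : (Fin n → ℝ) → ℝ) x)⁻¹, hs.inv hne⟩
  have hu : u * (b * b + h * h) = 1 := by
    apply Subtype.ext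
    funext x
    exact inv_mul_cancel₀ (hne x)
  apply hm.ne_top
  rw [Ideal.eq_top_iff_one, ← hu]
  exact m.mul_mem_left _ hk
end

section
/- Let {a_i : i ∈ Λ} be a family of elements of C^∞(ℝⁿ). The ideal generated by {a_i : i ∈ Λ} is the whole ring C^∞(ℝⁿ) if and only if for every C∞-radical prime ideal p of C^∞(ℝⁿ) there exists i ∈ Λ with a_i ∉ p. -/
/-- A family `{a_i}` of elements of `C^∞(ℝⁿ)` generates the unit ideal iff no C∞-radical prime
ideal contains all the `a_i`. -/
theorem span_eq_top_iff_not_subset_prime (n : ℕ) {Λ : Type*} (a : Λ → smoothRing n) :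
    Ideal.span (Set.range a) = ⊤ ↔
      ∀ p : Ideal (smoothRing n), p.IsPrime →
        (∀ g : smoothRing n, (∃ h ∈ p, zeroSet g = zeroSet h) → g ∈ p) →
        ∃ i : Λ, a i ∉ p := by
  constructor
  · intro htop p hp _
    by_contra hcon
    push Not at hcon
    apply hp.ne_top
    rw [eq_top_iff, ← htop, Ideal.span_le]
    rintro _ ⟨i, rfl⟩
    exact hcon i
  · intro H
    by_contra hne
    obtain ⟨m, hm, hle⟩ := Ideal.exists_le_maximal _ hne
    obtain ⟨i, hi⟩ := H m hm.isPrime (by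
      rintro g ⟨h, hh, hz⟩
      by_contra hg
      obtain ⟨u, v, hv, huv⟩ := hm.exists_inv hg
      have hw : h * h + v * v ∈ m := m.add_mem (m.mul_mem_left _ hh) (m.mul_mem_left _ hv)
      have hpos : ∀ x, (h * h + v * v : smoothRing n).1 x ≠ 0 := by
        intro x hx
        have hx' : h.1 x * h.1 x + v.1 x * v.1 x = 0 := hx
        have h0 : h.1 x = 0 := by nlinarith [mul_self_nonneg (h.1 x), mul_self_nonneg (v.1 x)]
        have v0 : v.1 x = 0 := by nlinarith [mul_self_nonneg (h.1 x), mul_self_nonneg (v.1 x)]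
        have g0 : g.1 x = 0 := by
          have : x ∈ zeroSet g := by rw [hz]; exact h0
          exact this
        have e : u.1 x * g.1 x + v.1 x = 1 := congrFun (congrArg Subtype.val huv) x
        rw [g0, v0] at e
        norm_num at e
      have hs : ContDiff ℝ (⊤ : ℕ∞) (h * h + v * v : smoothRing n).1 :=
        (h * h + v * v : smoothRing n).2
      let w : smoothRing n := ⟨fun x => ((h * h + v * v : smoothRing n).1 x)⁻¹, hs.inv hpos⟩
      apply hm.ne_top
      rw [Ideal.eq_top_iff_one]
      have e : w * (h * h + v * v) = 1 := by
        apply Subtype.ext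
        funext x
        exact inv_mul_cancel₀ (hpos x)
      rw [← e]
      exact m.mul_mem_left _ hw)
    exact hi (hle (Ideal.subset_span ⟨i, rfl⟩))
end
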